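/- arXiv:2403.13620 — 2 statements merged into one kernel-verified Lean document; each statement's English description precedes it below -/
import Mathlib

section
/- Let L > 0 and h₀ > 0 be real numbers and let j ≥ 1 be an integer, and set λ = j(j+1). Then the supremum, over all smooth functions h : [0,L] → ℝ with h(t) > 0 for all t ∈ [0,L), h(L) = 0, h'(L) = −1, and h(0) = h₀, of σ_rev(λ,h,L), equals Lλ/h₀² = Lj(j+1)/h₀². (This is the sharpness part of the paper's Theorem on metrics of revolution.) -/
open Set intervalIntegral

/-- The revolution Steklov–Rayleigh infimum `σ_rev(λ, h, L)`: the infimum, over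
continuously differentiable `a : ℝ → ℝ` with `a 0 = 1` and `a L = 0`, of
`(1 / h(0)²) ∫₀ᴸ (a'(t)² h(t)² + λ a(t)²) dt`. -/
noncomputable def steklovRayleighRev (lam L : ℝ) (h : ℝ → ℝ) : ℝ :=
  sInf { x : ℝ | ∃ a : ℝ → ℝ, ContDiff ℝ 1 a ∧ a 0 = 1 ∧ a L = 0 ∧
    x = (1 / (h 0) ^ 2) *
      ∫ t in (0:ℝ)..L, ((deriv a t) ^ 2 * (h t) ^ 2 + lam * (a t) ^ 2) }

/-- A binary quadratic form with nonnegative diagonal and nonnegative determinant is nonnegative. -/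
theorem quadraticForm_nonneg {X Z p : ℝ} (hX : 0 ≤ X) (hZ : 0 ≤ Z) (hp : p ^ 2 ≤ X * Z)
    (x y : ℝ) : 0 ≤ X * x ^ 2 + 2 * p * x * y + Z * y ^ 2 := by
  rcases hX.eq_or_lt with rfl | hX
  · have : p = 0 := by nlinarith
    subst this
    simp only [zero_mul, mul_zero, zero_add]
    positivity
  · have key : 0 ≤ X * (X * x ^ 2 + 2 * p * x * y + Z * y ^ 2) := by
      nlinarith [sq_nonneg (X * x + p * y), mul_nonneg (sub_nonneg.2 hp) (sq_nonneg y)]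
    exact nonneg_of_mul_nonneg_right key hX

theorem continuous_rayleigh_integrand {lam : ℝ} {a h : ℝ → ℝ} (ha : ContDiff ℝ 1 a)
    (hh : Continuous h) :
    Continuous fun t => (deriv a t) ^ 2 * (h t) ^ 2 + lam * (a t) ^ 2 := by
  have := ha.continuous_deriv le_rfl
  have := ha.continuous
  fun_prop

/-- A subsolution `p` of the Riccati equation `p' + lam = p² / h²` bounds the Rayleigh integral
from below by `p 0`. -/
theorem le_rayleigh_integral_of_riccati {lam L : ℝ} (hL : 0 ≤ L) {h p p' a : ℝ → ℝ}
    (hh : Continuous h) (hp : ∀ t ∈ Icc 0 L, HasDerivAt p (p' t) t)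
    (hp' : ContinuousOn p' (Icc 0 L)) (hnn : ∀ t ∈ Icc 0 L, 0 ≤ lam + p' t)
    (hric : ∀ t ∈ Icc 0 L, p t ^ 2 ≤ h t ^ 2 * (lam + p' t))
    (ha : ContDiff ℝ 1 a) (ha0 : a 0 = 1) (haL : a L = 0) :
    p 0 ≤ ∫ t in (0:ℝ)..L, ((deriv a t) ^ 2 * (h t) ^ 2 + lam * (a t) ^ 2) := by
  have hda := ha.continuous_deriv le_rfl
  have hpc : ContinuousOn p (Icc 0 L) := fun t ht => (hp t ht).continuousAt.continuousWithinAt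
  have hcont : ContinuousOn (fun t => -(2 * a t * deriv a t * p t + a t ^ 2 * p' t))
      (Icc 0 L) :=
    ((((continuous_const.mul ha.continuous).mul hda).continuousOn.mul hpc).add
      ((ha.continuous.pow 2).continuousOn.mul hp')).neg
  have hint : IntervalIntegrable (fun t => -(2 * a t * deriv a t * p t + a t ^ 2 * p' t))
      MeasureTheory.volume 0 L :=
    ContinuousOn.intervalIntegrable (by rwa [uIcc_of_le hL])
  have hftc := integral_eq_sub_of_hasDerivAt (f := fun t => -(a t ^ 2 * p t)) (a := 0) (b := L)
    (fun t ht => by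
      rw [uIcc_of_le hL] at ht
      have had := ((ha.differentiable one_ne_zero) t).hasDerivAt
      refine ((had.pow 2).mul (hp t ht)).neg.congr_deriv ?_
      simp) hint
  have hmono := integral_mono_on hL hint
    ((continuous_rayleigh_integrand (lam := lam) ha hh).intervalIntegrable 0 L) fun t ht => by
      have := quadraticForm_nonneg (sq_nonneg (h t)) (hnn t ht) (hric t ht) (deriv a t) (a t)
      linarith
  rw [hftc] at hmono
  simpa [ha0, haL] using hmono

theorem le_steklovRayleighRev {lam L T : ℝ} {h : ℝ → ℝ} (hL : 0 < L)
    (hT : ∀ a : ℝ → ℝ, ContDiff ℝ 1 a → a 0 = 1 → a L = 0 →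
      T ≤ ∫ t in (0:ℝ)..L, ((deriv a t) ^ 2 * (h t) ^ 2 + lam * (a t) ^ 2)) :
    T / h 0 ^ 2 ≤ steklovRayleighRev lam L h := by
  refine le_csInf ⟨_, fun t => 1 - t / L, by fun_prop, by simp, by simp [hL.ne'], rfl⟩ ?_
  rintro x ⟨a, ha, ha0, haL, rfl⟩
  rw [div_eq_mul_one_div, mul_comm]
  exact mul_le_mul_of_nonneg_left (hT a ha ha0 haL) (by positivity)

theorem steklovRayleighRev_le_of_test {lam L : ℝ} {h a : ℝ → ℝ} (hL : 0 ≤ L) (hlam : 0 ≤ lam)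
    (ha : ContDiff ℝ 1 a) (ha0 : a 0 = 1) (haL : a L = 0) :
    steklovRayleighRev lam L h ≤ (1 / (h 0) ^ 2) *
      ∫ t in (0:ℝ)..L, ((deriv a t) ^ 2 * (h t) ^ 2 + lam * (a t) ^ 2) := by
  refine csInf_le ⟨0, ?_⟩ ⟨a, ha, ha0, haL, rfl⟩
  rintro x ⟨a, -, -, -, rfl⟩
  exact mul_nonneg (by positivity) (integral_nonneg hL fun t _ => by positivity)

/-- A `C¹` function vanishing at `L` is dominated on `[0, L]` by a multiple of `L - t`. -/
theorem exists_sq_le_mul_sub_sq {L : ℝ} {h : ℝ → ℝ} (hL : 0 ≤ L) (hh : ContDiff ℝ 1 h)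
    (hhL : h L = 0) : ∃ C : ℝ, ∀ t ∈ Icc 0 L, h t ^ 2 ≤ C ^ 2 * (L - t) ^ 2 := by
  obtain ⟨C, hC⟩ := isCompact_Icc.exists_bound_of_continuousOn (s := Icc 0 L)
    (hh.continuous_deriv le_rfl).continuousOn
  refine ⟨C, fun t ht => ?_⟩
  have := (convex_Icc 0 L).norm_image_sub_le_of_norm_deriv_le
    (fun x _ => (hh.differentiable one_ne_zero) x) hC (right_mem_Icc.2 hL) ht
  rw [hhL, sub_zero, Real.norm_eq_abs, Real.norm_eq_abs, abs_sub_comm] at this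
  rw [← mul_pow, ← sq_abs (h t)]
  calc |h t| ^ 2 ≤ (C * |L - t|) ^ 2 := by gcongr
    _ = _ := by rw [mul_pow, mul_pow, sq_abs]

theorem integral_pow_mul_sub_sq (L : ℝ) (m : ℕ) :
    ∫ t in (0:ℝ)..L, t ^ (2 * m) * (L - t) ^ 2 =
      L ^ (2 * m + 3) * (2 / ((2 * m + 1) * (2 * m + 2) * (2 * m + 3))) := by
  have e : ∀ t : ℝ, t ^ (2 * m) * (L - t) ^ 2 =
      L ^ 2 * t ^ (2 * m) - 2 * L * t ^ (2 * m + 1) + t ^ (2 * m + 2) := fun t => by ring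
  simp_rw [e]
  rw [integral_add (by apply Continuous.intervalIntegrable; fun_prop)
      (by apply Continuous.intervalIntegrable; fun_prop),
    integral_sub (by apply Continuous.intervalIntegrable; fun_prop)
      (by apply Continuous.intervalIntegrable; fun_prop)]
  simp only [integral_const_mul, integral_pow]
  push_cast
  have h1 : (2 * m + 1 : ℝ) ≠ 0 := by positivity
  have h2 : (2 * m + 1 + 1 : ℝ) ≠ 0 := by positivity
  have h3 : (2 * m + 2 + 1 : ℝ) ≠ 0 := by positivity
  have h4 : (2 * m + 2 : ℝ) ≠ 0 := by positivity
  have h5 : (2 * m + 3 : ℝ) ≠ 0 := by positivity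
  field_simp
  ring

theorem rayleigh_integral_one_sub_pow_le {lam L C : ℝ} {h : ℝ → ℝ} (hL : 0 < L)
    (hlam : 0 ≤ lam) (hh : Continuous h)
    (hC : ∀ t ∈ Icc 0 L, h t ^ 2 ≤ C ^ 2 * (L - t) ^ 2) (m : ℕ) :
    ∫ t in (0:ℝ)..L, ((deriv (fun t => 1 - (t / L) ^ (m + 1)) t) ^ 2 * (h t) ^ 2 +
      lam * (1 - (t / L) ^ (m + 1)) ^ 2) ≤ L * lam + C ^ 2 * L * (1 / (m + 1)) := by
  have hd : ∀ t, deriv (fun t => 1 - (t / L) ^ (m + 1)) t = -((m + 1) * (t / L) ^ m / L) := by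
    intro t
    refine ((((hasDerivAt_id t).div_const L).pow (m + 1)).const_sub 1).deriv.trans ?_
    simp
    ring
  have hmono := integral_mono_on (μ := MeasureTheory.volume) hL.le
    ((continuous_rayleigh_integrand (lam := lam) (a := fun t => 1 - (t / L) ^ (m + 1))
      (by fun_prop) hh).intervalIntegrable 0 L)
    (g := fun t => C ^ 2 * (m + 1) ^ 2 / L ^ (2 * m + 2) * (t ^ (2 * m) * (L - t) ^ 2) + lam)
    (Continuous.intervalIntegrable (by fun_prop) 0 L) fun t ht => by
      have h0 : 0 ≤ t / L := div_nonneg ht.1 hL.le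
      have h1 : t / L ≤ 1 := (div_le_one hL).2 ht.2
      have ha1 : (t / L) ^ (m + 1) ≤ 1 := pow_le_one₀ h0 h1
      have ha0 : 0 ≤ (t / L) ^ (m + 1) := pow_nonneg h0 _
      have hsq : (1 - (t / L) ^ (m + 1)) ^ 2 ≤ 1 := by nlinarith
      refine add_le_add ?_ (by simpa using mul_le_mul_of_nonneg_left hsq hlam)
      rw [hd]
      calc (-((m + 1) * (t / L) ^ m / L)) ^ 2 * h t ^ 2
          ≤ (-((m + 1) * (t / L) ^ m / L)) ^ 2 * (C ^ 2 * (L - t) ^ 2) := by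
            gcongr
            exact hC t ht
        _ = _ := by
            rw [div_pow]
            field_simp
            ring
  refine hmono.trans ?_
  rw [integral_add (by apply Continuous.intervalIntegrable; fun_prop) (by simp),
    integral_const_mul, integral_pow_mul_sub_sq, integral_const, smul_eq_mul, sub_zero, add_comm]
  have e : C ^ 2 * (m + 1) ^ 2 / L ^ (2 * m + 2) *
      (L ^ (2 * m + 3) * (2 / ((2 * m + 1) * (2 * m + 2) * (2 * m + 3)))) =
      C ^ 2 * L * ((m + 1) / ((2 * m + 1) * (2 * m + 3))) := by
    have h4 : (2 * m + 2 : ℝ) = 2 * (m + 1) := by ring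
    rw [h4]
    field_simp
    ring
  rw [e]
  gcongr L * lam + C ^ 2 * L * ?_
  rw [div_le_div_iff₀ (by positivity) (by positivity)]
  nlinarith [(m.cast_nonneg : (0 : ℝ) ≤ m)]

theorem steklovRayleighRev_le {lam L : ℝ} {h : ℝ → ℝ} (hL : 0 < L) (hlam : 0 ≤ lam)
    (hh : ContDiff ℝ 1 h) (hhL : h L = 0) :
    steklovRayleighRev lam L h ≤ L * lam / h 0 ^ 2 := by
  obtain ⟨C, hC⟩ := exists_sq_le_mul_sub_sq hL.le hh hhL
  have hlim : Filter.Tendsto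
      (fun m : ℕ => 1 / (h 0) ^ 2 * (L * lam + C ^ 2 * L * (1 / ((m : ℝ) + 1))))
      Filter.atTop (nhds (1 / (h 0) ^ 2 * (L * lam + C ^ 2 * L * 0))) :=
    ((tendsto_one_div_add_atTop_nhds_zero_nat.const_mul _).const_add _).const_mul _
  rw [mul_zero, add_zero, one_div_mul_eq_div] at hlim
  refine ge_of_tendsto' hlim fun m => ?_
  refine (steklovRayleighRev_le_of_test (a := fun t => 1 - (t / L) ^ (m + 1)) hL.le hlam
    (by fun_prop) (by simp) (by simp [hL.ne'])).trans ?_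
  exact mul_le_mul_of_nonneg_left
    (rayleigh_integral_one_sub_pow_le hL hlam hh.continuous hC m) (by positivity)

/-- The warping function with `h 0 = h₀`, `h L = 0`, `h' L = -1`, large in the interior when `K`
is large. -/
noncomputable def steepProfile (L h₀ K t : ℝ) : ℝ :=
  (L - t) * ((h₀ * (L - t) / L + t) / L + K * t * (L - t))

theorem contDiff_steepProfile (L h₀ K : ℝ) {n : WithTop ℕ∞} :
    ContDiff ℝ n (steepProfile L h₀ K) := by
  unfold steepProfile
  fun_prop

theorem deriv_steepProfile_right {L : ℝ} (hL : L ≠ 0) (h₀ K : ℝ) :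
    deriv (steepProfile L h₀ K) L = -1 := by
  have hg : DifferentiableAt ℝ (fun t => (h₀ * (L - t) / L + t) / L + K * t * (L - t)) L := by
    fun_prop
  refine (((hasDerivAt_id L).const_sub L).mul hg.hasDerivAt).deriv.trans ?_
  simp [hL]

theorem mul_le_steepProfile {L h₀ K t : ℝ} (hL : 0 < L) (ht : t ∈ Icc 0 L) :
    (L - t) ^ 2 * (h₀ / L ^ 2 + K * t) ≤ steepProfile L h₀ K t := by
  have e : steepProfile L h₀ K t =
      (L - t) ^ 2 * (h₀ / L ^ 2 + K * t) + (L - t) * t / L := by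
    unfold steepProfile
    field_simp
    ring
  rw [e]
  have := div_nonneg (mul_nonneg (sub_nonneg.2 ht.2) ht.1) hL.le
  linarith

theorem hasDerivAt_riccatiSubsolution {lam L d e c K t : ℝ} (hs : L - t + d ≠ 0)
    (hD : c + K * t ≠ 0) :
    HasDerivAt (fun t => (L - t) ^ 2 * (lam / (L - t + d) - e / (c + K * t)))
      (-2 * (L - t) * (lam / (L - t + d) - e / (c + K * t)) +
        (L - t) ^ 2 * (lam / (L - t + d) ^ 2 + e * K / (c + K * t) ^ 2)) t := by
  have hl : HasDerivAt (fun t => L - t) (-1) t := (hasDerivAt_id t).const_sub L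
  have hk : HasDerivAt (fun t => c + K * t) K t := by
    simpa using ((hasDerivAt_id t).const_mul K).const_add c
  refine ((hl.pow 2).mul (((hasDerivAt_const t lam).div (hl.add_const d) hs).sub
    ((hasDerivAt_const t e).div hk hD))).congr_deriv ?_
  simp only [Pi.pow_apply, Pi.sub_apply, Pi.div_apply]
  push_cast
  ring

theorem riccati_slack_eq {lam s d e D K : ℝ} (hs : s + d ≠ 0) (hD : D ≠ 0) :
    lam + (-2 * s * (lam / (s + d) - e / D) + s ^ 2 * (lam / (s + d) ^ 2 + e * K / D ^ 2)) =
      lam * d ^ 2 / (s + d) ^ 2 + 2 * s * e / D + s ^ 2 * e * K / D ^ 2 := by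
  field_simp
  ring

theorem exists_riccati_parameter {lam L d e c : ℝ} (hlam : 0 < lam) (hL : 0 < L) (hd : 0 < d)
    (he : 0 < e) (hc : 0 < c) : ∃ K : ℝ, 0 < K ∧ ∀ t ∈ Icc 0 L,
      (lam / (L - t + d) - e / (c + K * t)) ^ 2 ≤
        (lam * d ^ 2 / (L - t + d) ^ 2 + 2 * (L - t) * e / (c + K * t) +
          (L - t) ^ 2 * e * K / (c + K * t) ^ 2) * (c + K * t) ^ 2 := by
  set R := lam / d + e / c with hR
  set κ := lam * d ^ 2 / (L + d) ^ 2 with hκ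
  have hRpos : 0 < R := by positivity
  have hκpos : 0 < κ := by positivity
  set K := 1 + 4 * R ^ 2 / (e * L ^ 2) + 4 * R ^ 2 / (κ * L ^ 2) with hK
  have hx : 0 < 4 * R ^ 2 / (e * L ^ 2) := by positivity
  have hy : 0 < 4 * R ^ 2 / (κ * L ^ 2) := by positivity
  have hK1 : 1 ≤ K := by linarith
  have hKe : 4 * R ^ 2 ≤ K * (e * L ^ 2) := (div_le_iff₀ (by positivity)).1 (by linarith)
  have hKκ : 4 * R ^ 2 ≤ K * (κ * L ^ 2) := (div_le_iff₀ (by positivity)).1 (by linarith)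
  clear_value K
  refine ⟨K, by linarith, fun t ⟨ht0, htL⟩ => ?_⟩
  have hs : 0 ≤ L - t := sub_nonneg.2 htL
  have hKt : 0 ≤ K * t := by positivity
  have hD : 0 < c + K * t := by positivity
  have hr : (lam / (L - t + d) - e / (c + K * t)) ^ 2 ≤ R ^ 2 := by
    have h1 : lam / (L - t + d) ≤ lam / d := by gcongr; linarith
    have h2 : e / (c + K * t) ≤ e / c := by gcongr; linarith
    have h3 : 0 < lam / (L - t + d) := by positivity
    have h4 : 0 < e / (c + K * t) := by positivity
    exact sq_le_sq' (by linarith) (by linarith)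
  have hκle : κ ≤ lam * d ^ 2 / (L - t + d) ^ 2 := by
    rw [hκ]
    gcongr
    linarith
  have hmain : κ * (K * t) ^ 2 + (L - t) ^ 2 * e * K ≤
      (lam * d ^ 2 / (L - t + d) ^ 2 + 2 * (L - t) * e / (c + K * t) +
          (L - t) ^ 2 * e * K / (c + K * t) ^ 2) * (c + K * t) ^ 2 := by
    rw [add_mul _ _ ((c + K * t) ^ 2), div_mul_cancel₀ _ (by positivity)]
    gcongr
    · have : 0 ≤ 2 * (L - t) * e / (c + K * t) := by positivity
      linarith
    · linarith
  refine hr.trans (le_trans ?_ hmain)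
  rcases le_total t (L / 2) with h | h
  · have h1 : L ^ 2 / 4 ≤ (L - t) ^ 2 := by
      have : (L / 2) ^ 2 ≤ (L - t) ^ 2 := by gcongr; linarith
      linarith
    have h2 : L ^ 2 / 4 * (e * K) ≤ (L - t) ^ 2 * (e * K) := by gcongr
    have h3 : 0 ≤ κ * (K * t) ^ 2 := by positivity
    linarith
  · have h1 : L ^ 2 / 4 ≤ t ^ 2 := by
      have : (L / 2) ^ 2 ≤ t ^ 2 := by gcongr
      linarith
    have h2 : K * (L ^ 2 / 4) ≤ K ^ 2 * t ^ 2 := by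
      have : K ≤ K ^ 2 := le_self_pow₀ hK1 two_ne_zero
      gcongr
    have h3 : κ * (K * (L ^ 2 / 4)) ≤ κ * (K ^ 2 * t ^ 2) := by gcongr
    have h4 : 0 ≤ (L - t) ^ 2 * e * K := by positivity
    linarith

theorem exists_profile_le_steklovRayleighRev {lam L h₀ T : ℝ} (hL : 0 < L) (hh₀ : 0 < h₀)
    (hlam : 0 < lam) (hT : T < L * lam) :
    ∃ h : ℝ → ℝ, ContDiff ℝ (⊤ : ℕ∞) h ∧ (∀ t ∈ Ico (0:ℝ) L, 0 < h t) ∧ h L = 0 ∧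
      deriv h L = -1 ∧ h 0 = h₀ ∧ T / h₀ ^ 2 ≤ steklovRayleighRev lam L h := by
  set c := h₀ / L ^ 2 with hc
  have hcpos : 0 < c := by positivity
  obtain ⟨d, hd, hTd⟩ : ∃ d : ℝ, 0 < d ∧ T < L ^ 2 * (lam / (L + d) - d / c) := by
    have hcont : ContinuousAt (fun d : ℝ => L ^ 2 * (lam / (L + d) - d / c)) 0 := by
      have : L + 0 ≠ 0 := by simpa using hL.ne'
      fun_prop (disch := assumption)
    have h0 : T < L ^ 2 * (lam / (L + 0) - 0 / c) := by
      have : L ^ 2 * (lam / (L + 0) - 0 / c) = L * lam := by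
        rw [add_zero, zero_div, sub_zero]
        field_simp
      rwa [this]
    have hev := (hcont.eventually (lt_mem_nhds h0)).filter_mono
      (nhdsWithin_le_nhds (s := Ioi 0))
    obtain ⟨d, hTd, hd⟩ := (hev.and self_mem_nhdsWithin).exists
    exact ⟨d, hd, hTd⟩
  obtain ⟨K, hK, hric⟩ := exists_riccati_parameter hlam hL hd hd hcpos
  have hs : ∀ t ∈ Icc 0 L, L - t + d ≠ 0 := fun t ht => by linarith [ht.2]
  have hD : ∀ t ∈ Icc 0 L, 0 < c + K * t := fun t ht => by
    have := mul_nonneg hK.le ht.1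
    linarith
  have hle : ∀ t ∈ Icc 0 L, (L - t) ^ 2 * (c + K * t) ≤ steepProfile L h₀ K t := fun t ht =>
    mul_le_steepProfile hL ht
  have h0 : steepProfile L h₀ K 0 = h₀ := by
    unfold steepProfile
    field_simp
    ring
  refine ⟨steepProfile L h₀ K, contDiff_steepProfile L h₀ K, fun t ht => ?_,
    by simp [steepProfile], deriv_steepProfile_right hL.ne' h₀ K, h0, ?_⟩
  · have h1 := hD t (Ico_subset_Icc_self ht)
    have h2 : 0 < L - t := sub_pos.2 ht.2
    exact (by positivity : 0 < (L - t) ^ 2 * (c + K * t)).trans_le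
      (hle t (Ico_subset_Icc_self ht))
  · nth_rw 1 [← h0]
    refine le_steklovRayleighRev hL fun a ha ha0 haL => hTd.le.trans ?_
    have hslack : ∀ t ∈ Icc 0 L, 0 ≤ lam * d ^ 2 / (L - t + d) ^ 2 +
        2 * (L - t) * d / (c + K * t) + (L - t) ^ 2 * d * K / (c + K * t) ^ 2 := fun t ht => by
      have h1 := hD t ht
      have h2 : 0 ≤ L - t := sub_nonneg.2 ht.2
      positivity
    have key := le_rayleigh_integral_of_riccati (lam := lam) hL.le
      (contDiff_steepProfile L h₀ K (n := 0)).continuous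
      (fun t ht => hasDerivAt_riccatiSubsolution (lam := lam) (e := d) (hs t ht) (hD t ht).ne')
      ?_ (fun t ht => ?_) (fun t ht => ?_) ha ha0 haL
    · simpa using key
    · have hD' : ∀ t ∈ Icc 0 L, c + K * t ≠ 0 := fun t ht => (hD t ht).ne'
      have hs2 : ∀ t ∈ Icc 0 L, (L - t + d) ^ 2 ≠ 0 := fun t ht => pow_ne_zero 2 (hs t ht)
      have hD2 : ∀ t ∈ Icc 0 L, (c + K * t) ^ 2 ≠ 0 := fun t ht => pow_ne_zero 2 (hD' t ht)
      fun_prop (disch := assumption)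
    · rw [riccati_slack_eq (hs t ht) (hD t ht).ne']
      exact hslack t ht
    · rw [riccati_slack_eq (hs t ht) (hD t ht).ne', mul_pow]
      have hD0 := hD t ht
      calc ((L - t) ^ 2) ^ 2 * (lam / (L - t + d) - d / (c + K * t)) ^ 2
          ≤ ((L - t) ^ 2) ^ 2 * ((lam * d ^ 2 / (L - t + d) ^ 2 +
            2 * (L - t) * d / (c + K * t) + (L - t) ^ 2 * d * K / (c + K * t) ^ 2) *
              (c + K * t) ^ 2) := by
            gcongr
            exact hric t ht
        _ = ((L - t) ^ 2 * (c + K * t)) ^ 2 * (lam * d ^ 2 / (L - t + d) ^ 2 +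
            2 * (L - t) * d / (c + K * t) + (L - t) ^ 2 * d * K / (c + K * t) ^ 2) := by ring
        _ ≤ _ := by
            gcongr
            · exact hslack t ht
            · exact hle t ht

theorem steklovRev_sup_eq (L h₀ : ℝ) (hL : 0 < L) (hh₀ : 0 < h₀)
    (j : ℕ) (hj : 1 ≤ j) :
    sSup { x : ℝ | ∃ h : ℝ → ℝ, ContDiff ℝ (⊤ : ℕ∞) h ∧
        (∀ t ∈ Ico (0:ℝ) L, 0 < h t) ∧ h L = 0 ∧ deriv h L = -1 ∧ h 0 = h₀ ∧
        x = steklovRayleighRev ((j : ℝ) * (j + 1)) L h } =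
      L * ((j : ℝ) * (j + 1)) / h₀ ^ 2 := by
  have hlam : 0 < (j : ℝ) * (j + 1) := by positivity
  apply csSup_eq_of_forall_le_of_forall_lt_exists_gt
  · obtain ⟨h, hh, hpos, hhL, hd, h0, -⟩ := exists_profile_le_steklovRayleighRev hL hh₀ hlam
      (T := 0) (by positivity)
    exact ⟨_, h, hh, hpos, hhL, hd, h0, rfl⟩
  · rintro x ⟨h, hh, -, hhL, -, rfl, rfl⟩
    exact steklovRayleighRev_le hL hlam.le (hh.of_le (by exact_mod_cast le_top)) hhL
  · intro w hw
    obtain ⟨w', hw', hlt⟩ := exists_between hw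
    obtain ⟨h, hh, hpos, hhL, hd, h0, hle⟩ := exists_profile_le_steklovRayleighRev hL hh₀ hlam
      (T := w' * h₀ ^ 2) ((lt_div_iff₀ (by positivity)).1 hlt)
    refine ⟨_, ⟨h, hh, hpos, hhL, hd, h0, rfl⟩, hw'.trans_le ?_⟩
    rwa [mul_div_cancel_right₀ _ (by positivity)] at hle
end

section
/- Let L > 0 and λ > 0. Then the infimum, over all smooth functions h : ℝ → ℝ with h(t) > 0 for all t ∈ [0,L] and h(0) = h(L) = 1, of σ(λ,h,L), equals 0. (This is the conclusion of the paper's Remark 2.3: there is no nontrivial lower bound for the Steklov eigenvalues σ_j(h) among metrics satisfying condition (H).) -/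
open Set intervalIntegral

/-- The Steklov–Rayleigh infimum `σ(λ, h, L)`: the infimum, over continuously
differentiable `a : ℝ → ℝ` with `a 0 ^ 2 + a L ^ 2 = 1`, of
`∫₀ᴸ (a'(t)² h(t)² + λ a(t)²) dt`. -/
noncomputable def steklovRayleigh (lam L : ℝ) (h : ℝ → ℝ) : ℝ :=
  sInf { x : ℝ | ∃ a : ℝ → ℝ, ContDiff ℝ 1 a ∧ (a 0) ^ 2 + (a L) ^ 2 = 1 ∧
    x = ∫ t in (0:ℝ)..L, ((deriv a t) ^ 2 * (h t) ^ 2 + lam * (a t) ^ 2) }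

lemma integral_one_sub_div_pow {L : ℝ} (hL : L ≠ 0) (k : ℕ) :
    ∫ t in (0:ℝ)..L, (1 - t / L) ^ k = L / (k + 1) := by
  have h := intervalIntegral.integral_comp_sub_div (a := 0) (b := L)
    (fun x : ℝ => x ^ k) hL 1
  rw [h]
  simp [hL, integral_pow, div_eq_mul_inv]

lemma integral_one_sub_two_mul_div_pow {L : ℝ} (hL : L ≠ 0) (m : ℕ) :
    ∫ t in (0:ℝ)..L, (1 - t / (L / 2)) ^ (2 * m) = L / (2 * m + 1) := by
  have h := intervalIntegral.integral_comp_sub_div (a := 0) (b := L)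
    (fun x : ℝ => x ^ (2 * m)) (div_ne_zero hL two_ne_zero) 1
  have hLL : L / (L / 2) = 2 := by field_simp
  rw [h, hLL, integral_pow]
  have hodd : (1 - 2 : ℝ) ^ (2 * m + 1) = -1 := by
    norm_num [pow_succ, pow_mul]
  rw [hodd]
  simp only [zero_div, sub_zero, one_pow, smul_eq_mul]
  push_cast
  field_simp
  ring

lemma steklov_integral_nonneg {L lam : ℝ} (hL : 0 ≤ L) (hlam : 0 ≤ lam) (h a : ℝ → ℝ) :
    0 ≤ ∫ t in (0:ℝ)..L, ((deriv a t) ^ 2 * (h t) ^ 2 + lam * (a t) ^ 2) :=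
  intervalIntegral.integral_nonneg hL fun _ _ => by positivity

lemma steklovRayleigh_nonneg {L lam : ℝ} (hL : 0 ≤ L) (hlam : 0 ≤ lam) (h : ℝ → ℝ) :
    0 ≤ steklovRayleigh lam L h := by
  apply Real.sInf_nonneg
  rintro x ⟨a, -, -, rfl⟩
  exact steklov_integral_nonneg hL hlam h a

lemma steklovRayleigh_le {L lam : ℝ} (hL : 0 ≤ L) (hlam : 0 ≤ lam) (h : ℝ → ℝ)
    {a : ℝ → ℝ} (ha : ContDiff ℝ 1 a) (hab : (a 0) ^ 2 + (a L) ^ 2 = 1) :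
    steklovRayleigh lam L h ≤
      ∫ t in (0:ℝ)..L, ((deriv a t) ^ 2 * (h t) ^ 2 + lam * (a t) ^ 2) := by
  refine csInf_le ⟨0, ?_⟩ ⟨a, ha, hab, rfl⟩
  rintro x ⟨b, -, -, rfl⟩
  exact steklov_integral_nonneg hL hlam h b

/-- A polynomial warping function equal to `1` at `0` and `L` and small in between. -/
noncomputable def dippedWarping (L : ℝ) (m : ℕ) (t : ℝ) : ℝ :=
  1 / (m + 1) + (1 - 1 / (m + 1)) * (1 - t / (L / 2)) ^ (2 * m)

lemma contDiff_dippedWarping (L : ℝ) (m : ℕ) {n : WithTop ℕ∞} :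
    ContDiff ℝ n (dippedWarping L m) := by
  unfold dippedWarping
  fun_prop

lemma one_div_nat_add_one_le_one (m : ℕ) : (1 : ℝ) / (m + 1) ≤ 1 := by
  rw [div_le_one (by positivity)]
  linarith [m.cast_nonneg (α := ℝ)]

lemma dippedWarping_pos (L : ℝ) (m : ℕ) (t : ℝ) : 0 < dippedWarping L m t := by
  have h1 : (0 : ℝ) < 1 / (m + 1) := by positivity
  have h2 := one_div_nat_add_one_le_one m
  have h3 : 0 ≤ (1 - t / (L / 2)) ^ (2 * m) := (even_two_mul m).pow_nonneg _
  have h4 := mul_nonneg (sub_nonneg.2 h2) h3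
  unfold dippedWarping
  linarith

lemma dippedWarping_sq_le {L t : ℝ} (hL : 0 < L) (ht : t ∈ Icc 0 L) (m : ℕ) :
    dippedWarping L m t ^ 2 ≤ 1 / (m + 1) + (1 - t / (L / 2)) ^ (2 * m) := by
  have h1 : (0 : ℝ) < 1 / (m + 1) := by positivity
  have h2 := one_div_nat_add_one_le_one m
  have h3 : 0 ≤ (1 - t / (L / 2)) ^ (2 * m) := (even_two_mul m).pow_nonneg _
  have h4 : (1 - t / (L / 2)) ^ (2 * m) ≤ 1 := by
    have h5 : 0 ≤ t / (L / 2) := div_nonneg ht.1 (by positivity)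
    have h6 : t / (L / 2) ≤ 2 := by
      rw [div_le_iff₀ (by positivity)]
      linarith [ht.2]
    rw [pow_mul]
    exact pow_le_one₀ (sq_nonneg _) (by nlinarith)
  have hpos := dippedWarping_pos L m t
  have hle : dippedWarping L m t ≤ 1 := by
    unfold dippedWarping
    nlinarith
  calc dippedWarping L m t ^ 2 ≤ dippedWarping L m t := by nlinarith
    _ ≤ _ := by
      unfold dippedWarping
      nlinarith

lemma steklovRayleigh_dippedWarping_le {L lam : ℝ} (hL : 0 < L) (hlam : 0 ≤ lam) (n m : ℕ) :
    steklovRayleigh lam L (dippedWarping L m) ≤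
      ((n + 1) / L) ^ 2 * (2 * L) * (1 / ((m : ℝ) + 1)) + lam * L * (1 / ((n : ℝ) + 1)) := by
  have hL0 := hL.ne'
  set a : ℝ → ℝ := fun t => (1 - t / L) ^ (n + 1)
  have ha : ContDiff ℝ 1 a := by fun_prop
  have hda (t : ℝ) : deriv a t = (n + 1) * (1 - t / L) ^ n * (-(1 / L)) := by
    simp [a]
  refine (steklovRayleigh_le hL.le hlam _ ha (by simp [a, hL0])).trans ?_
  have hbound : ∀ t ∈ Icc 0 L,
      deriv a t ^ 2 * dippedWarping L m t ^ 2 + lam * a t ^ 2 ≤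
        ((n + 1) / L) ^ 2 * (1 / ((m : ℝ) + 1) + (1 - t / (L / 2)) ^ (2 * m)) +
          lam * (1 - t / L) ^ (2 * (n + 1)) := by
    intro t ht
    have h0 : 0 ≤ 1 - t / L := by
      rw [sub_nonneg, div_le_one hL]
      exact ht.2
    have h1 : 1 - t / L ≤ 1 := by
      linarith [div_nonneg ht.1 hL.le]
    have h2 : deriv a t ^ 2 ≤ ((n + 1) / L) ^ 2 := by
      have : deriv a t ^ 2 = ((n + 1) / L) ^ 2 * ((1 - t / L) ^ n) ^ 2 := by
        rw [hda]
        ring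
      rw [this]
      exact mul_le_of_le_one_right (sq_nonneg _)
        (pow_le_one₀ (pow_nonneg h0 _) (pow_le_one₀ h0 h1))
    have h3 : a t ^ 2 = (1 - t / L) ^ (2 * (n + 1)) := by
      simp only [a]
      ring
    rw [h3]
    gcongr
    exact dippedWarping_sq_le hL ht m
  have hcont : Continuous (deriv a) := ha.continuous_deriv le_rfl
  have hh : Continuous (dippedWarping L m) := (contDiff_dippedWarping L m (n := 0)).continuous
  have hac := ha.continuous
  refine (intervalIntegral.integral_mono_on hL.le
    (Continuous.intervalIntegrable (by fun_prop) _ _)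
    (Continuous.intervalIntegrable (by fun_prop) _ _) hbound).trans ?_
  rw [intervalIntegral.integral_add (Continuous.intervalIntegrable (by fun_prop) _ _)
      (Continuous.intervalIntegrable (by fun_prop) _ _),
    intervalIntegral.integral_const_mul, intervalIntegral.integral_const_mul,
    intervalIntegral.integral_add (Continuous.intervalIntegrable (by fun_prop) _ _)
      (Continuous.intervalIntegrable (by fun_prop) _ _),
    integral_one_sub_div_pow hL0, integral_one_sub_two_mul_div_pow hL0,
    intervalIntegral.integral_const, smul_eq_mul, sub_zero]
  have hm : L / (2 * (m : ℝ) + 1) ≤ L * (1 / (m + 1)) := by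
    rw [mul_one_div]
    gcongr
    linarith [m.cast_nonneg (α := ℝ)]
  have hn : L / (((2 * (n + 1) : ℕ) : ℝ) + 1) ≤ L * (1 / (n + 1)) := by
    rw [mul_one_div]
    push_cast
    gcongr
    linarith [n.cast_nonneg (α := ℝ)]
  have hm' := mul_le_mul_of_nonneg_left hm (sq_nonneg (((n : ℝ) + 1) / L))
  have hn' := mul_le_mul_of_nonneg_left hn hlam
  linarith

theorem steklov_inf_eq_zero (L lam : ℝ) (hL : 0 < L) (hlam : 0 < lam) :
    sInf { x : ℝ | ∃ h : ℝ → ℝ, ContDiff ℝ (⊤ : ℕ∞) h ∧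
        (∀ t ∈ Icc (0:ℝ) L, 0 < h t) ∧ h 0 = 1 ∧ h L = 1 ∧
        x = steklovRayleigh lam L h } = 0 := by
  have hnonneg : ∀ x ∈ { x : ℝ | ∃ h : ℝ → ℝ, ContDiff ℝ (⊤ : ℕ∞) h ∧
      (∀ t ∈ Icc (0:ℝ) L, 0 < h t) ∧ h 0 = 1 ∧ h L = 1 ∧
      x = steklovRayleigh lam L h }, 0 ≤ x := by
    rintro x ⟨h, -, -, -, -, rfl⟩
    exact steklovRayleigh_nonneg hL.le hlam.le h
  refine le_antisymm ?_ (Real.sInf_nonneg hnonneg)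
  have hle (n m : ℕ) := (csInf_le ⟨0, hnonneg⟩
    ⟨dippedWarping L m, contDiff_dippedWarping L m, fun t _ => dippedWarping_pos L m t,
      by simp [dippedWarping],
      by
        have hLL : L / (L / 2) = 2 := by field_simp
        simp only [dippedWarping, hLL, pow_mul]
        norm_num, rfl⟩).trans (steklovRayleigh_dippedWarping_le hL hlam.le n m)
  have hlim := tendsto_one_div_add_atTop_nhds_zero_nat (𝕜 := ℝ)
  have hle' (n : ℕ) := ge_of_tendsto' ((hlim.const_mul _).add_const _) (hle n)
  simp only [mul_zero, zero_add] at hle'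
  simpa using ge_of_tendsto' (hlim.const_mul (lam * L)) hle'
end
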